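/- Let A be an n'×n complex matrix of rank n' with singular values σ₁ ≥ ... ≥ σ_{n'} > 0 and rows X₁,...,X_{n'}. Suppose k < n' and each row satisfies dist(Xᵢ, span of the other n'−1 rows) ≥ D > 0. Then for every 1 ≤ m ≤ n', (n' − m + 1) σ_m^{−2} ≤ ∑_{j=1}^{n'} σⱼ^{−2} ≤ n'/D², hence σ_m ≥ D √((n'−m+1)/n'). -/

import Mathlib

namespace Matrix

/-- The trace of the inverse of an invertible Hermitian matrix is the sum of the inverses of its
eigenvalues. -/
theorem IsHermitian.trace_inv_eq_sum_inv_eigenvalues {ι 𝕜 : Type*} [Fintype ι] [DecidableEq ι]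
    [RCLike 𝕜] {G : Matrix ι ι 𝕜} (hG : G.IsHermitian) (hne : ∀ i, hG.eigenvalues i ≠ 0) :
    G⁻¹.trace = ∑ i, ((hG.eigenvalues i : 𝕜))⁻¹ := by
  have hinv : G⁻¹ = Unitary.conjStarAlgAut 𝕜 _ hG.eigenvectorUnitary
      (diagonal fun i => ((hG.eigenvalues i : 𝕜))⁻¹) := by
    apply inv_eq_right_inv
    nth_rewrite 1 [hG.spectral_theorem]
    rw [← map_mul, diagonal_mul_diagonal]
    have : (diagonal fun i => (RCLike.ofReal ∘ hG.eigenvalues) i * ((hG.eigenvalues i : 𝕜))⁻¹)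
        = (1 : Matrix ι ι 𝕜) := by
      rw [← diagonal_one]
      congr 1
      funext i
      exact mul_inv_cancel₀ (RCLike.ofReal_ne_zero.2 (hne i))
    rw [this, map_one]
  rw [hinv, Unitary.conjStarAlgAut_apply, trace_mul_comm, ← mul_assoc]
  simp [trace_diagonal]

/-- A diagonal entry of the inverse Gram matrix of the rows of `A` is at most `1 / D ^ 2` if the
corresponding row is at distance at least `D` from the span of the others. -/
theorem re_inv_mul_conjTranspose_apply_self_le {ι κ 𝕜 : Type*} [Fintype ι] [DecidableEq ι]
    [Fintype κ] [RCLike 𝕜] {A : Matrix ι κ 𝕜} (hA : IsUnit (A * Aᴴ).det) {D : ℝ} (hD : 0 < D)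
    (i : ι)
    (hdist : D ≤ Metric.infDist (WithLp.toLp 2 (A i))
      ((Submodule.span 𝕜 ((fun j => WithLp.toLp 2 (A j)) '' {j | j ≠ i}) :
          Submodule 𝕜 (EuclideanSpace 𝕜 κ)) : Set (EuclideanSpace 𝕜 κ))) :
    RCLike.re ((A * Aᴴ)⁻¹ i i) ≤ 1 / D ^ 2 := by
  set G := A * Aᴴ with hGdef
  have hG : G.IsHermitian := isHermitian_mul_conjTranspose_self A
  set c := G⁻¹ i i with hc
  have hnorm : ‖WithLp.toLp 2 ((G⁻¹ * A) i)‖ ^ 2 = RCLike.re c := by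
    have h : (G⁻¹ * A) * (G⁻¹ * A)ᴴ = G⁻¹ := by
      rw [conjTranspose_mul, hG.inv.eq, Matrix.mul_assoc, ← Matrix.mul_assoc A, ← hGdef,
        mul_nonsing_inv _ hA, Matrix.mul_one]
    rw [hc, ← congrFun (congrFun h i) i, EuclideanSpace.norm_sq_eq, mul_apply, map_sum]
    refine Finset.sum_congr rfl fun j _ => ?_
    rw [conjTranspose_apply, RCLike.star_def, RCLike.mul_conj, ← RCLike.ofReal_pow, RCLike.ofReal_re]
  have hsum : WithLp.toLp 2 ((G⁻¹ * A) i)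
      = c • WithLp.toLp 2 (A i) + ∑ j ∈ Finset.univ.erase i, G⁻¹ i j • WithLp.toLp 2 (A j) := by
    rw [Finset.add_sum_erase _ (fun j => G⁻¹ i j • WithLp.toLp 2 (A j)) (Finset.mem_univ i)]
    ext k
    simp [mul_apply]
  have hle : ‖c‖ * D ≤ ‖WithLp.toLp 2 ((G⁻¹ * A) i)‖ := by
    rcases eq_or_ne c 0 with h0 | h0
    · simp [h0]
    have hmem : -∑ j ∈ Finset.univ.erase i, (c⁻¹ * G⁻¹ i j) • WithLp.toLp 2 (A j) ∈
        Submodule.span 𝕜 ((fun j => WithLp.toLp 2 (A j)) '' {j | j ≠ i}) :=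
      neg_mem <| sum_mem fun j hj => Submodule.smul_mem _ _ <|
        Submodule.subset_span ⟨j, Finset.ne_of_mem_erase hj, rfl⟩
    have h1 := hdist.trans (Metric.infDist_le_dist_of_mem hmem)
    rw [dist_eq_norm, sub_neg_eq_add] at h1
    have h2 : WithLp.toLp 2 ((G⁻¹ * A) i) = c • (WithLp.toLp 2 (A i)
        + ∑ j ∈ Finset.univ.erase i, (c⁻¹ * G⁻¹ i j) • WithLp.toLp 2 (A j)) := by
      simp only [hsum, smul_add, Finset.smul_sum, smul_smul, mul_inv_cancel_left₀ h0]
    rw [h2, norm_smul]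
    gcongr
  have hre : RCLike.re c ≤ ‖c‖ := RCLike.re_le_norm c
  rw [le_div_iff₀ (by positivity)]
  rcases le_or_gt (RCLike.re c) 0 with h | h
  · nlinarith [sq_nonneg D]
  · have h3 : (RCLike.re c * D) ^ 2 ≤ RCLike.re c := by
      rw [← hnorm]
      gcongr
      rw [hnorm]
      exact (mul_le_mul_of_nonneg_right hre hD.le).trans hle
    nlinarith

end Matrix

/-- An antitone positive family on `Fin N` has its last `N - i` inverse squares at least as large
as the `i`-th. -/
theorem Antitone.sub_mul_inv_sq_le_sum_inv_sq {N : ℕ} {σ : Fin N → ℝ} (hσ : Antitone σ)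
    (hpos : ∀ i, 0 < σ i) (i : Fin N) :
    ((N - (i : ℕ) : ℕ) : ℝ) * (σ i ^ 2)⁻¹ ≤ ∑ j, (σ j ^ 2)⁻¹ := by
  calc ((N - (i : ℕ) : ℕ) : ℝ) * (σ i ^ 2)⁻¹ = ∑ _j ∈ Finset.Ici i, (σ i ^ 2)⁻¹ := by simp
    _ ≤ ∑ j ∈ Finset.Ici i, (σ j ^ 2)⁻¹ := by
        refine Finset.sum_le_sum fun j hj => ?_
        have := hpos j
        have := hσ (Finset.mem_Ici.1 hj)
        gcongr
    _ ≤ ∑ j, (σ j ^ 2)⁻¹ :=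
        Finset.sum_le_sum_of_subset_of_nonneg (Finset.subset_univ _) fun j _ _ => by positivity


/-- Lower bounds for intermediate singular values: if every row of a full-rank
`n' × n` matrix `A` is at distance at least `D > 0` from the span of the other rows,
then for every `m` (0-indexed as `i`, so `m = i + 1` and `n' - m + 1 = n' - i`),
`(n' - m + 1) σ_m⁻² ≤ ∑ⱼ σⱼ⁻² ≤ n'/D²`, hence `σ_m ≥ D √((n'-m+1)/n')`. -/
theorem stmt_15 (n n' : ℕ) (hn'1 : 1 ≤ n') (hn' : n' ≤ n)
    (A : Matrix (Fin n') (Fin n) ℂ) (hrank : A.rank = n')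
    (σ : Fin n' → ℝ) (hσ0 : ∀ i, 0 < σ i) (hσmono : Antitone σ)
    (hσ : (Matrix.charpoly (A * A.conjTranspose)).roots
      = Multiset.map (fun i => ((σ i : ℂ)) ^ 2) Finset.univ.val)
    (D : ℝ) (hD : 0 < D)
    (hdist : ∀ i, D ≤ Metric.infDist ((WithLp.equiv 2 (Fin n → ℂ)).symm (A i))
      ((Submodule.span ℂ
        ((fun j => (WithLp.equiv 2 (Fin n → ℂ)).symm (A j)) '' {j | j ≠ i}) :
          Submodule ℂ (EuclideanSpace ℂ (Fin n))) : Set (EuclideanSpace ℂ (Fin n)))) :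
    ∀ i : Fin n',
      ((n' - (i : ℕ) : ℕ) : ℝ) * (σ i ^ 2)⁻¹ ≤ ∑ j, (σ j ^ 2)⁻¹ ∧
      ∑ j, (σ j ^ 2)⁻¹ ≤ (n' : ℝ) / D ^ 2 ∧
      D * Real.sqrt (((n' - (i : ℕ) : ℕ) : ℝ) / n') ≤ σ i := by
  have hG : (A * A.conjTranspose).IsHermitian := Matrix.isHermitian_mul_conjTranspose_self A
  have heig : Multiset.map (fun i => (hG.eigenvalues i : ℂ)) Finset.univ.val
      = Multiset.map (fun i => ((σ i : ℂ)) ^ 2) Finset.univ.val :=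
    hG.roots_charpoly_eq_eigenvalues.symm.trans hσ
  have hne : ∀ i, hG.eigenvalues i ≠ 0 := by
    intro i h
    have hmem : (hG.eigenvalues i : ℂ) ∈
        Multiset.map (fun i => ((σ i : ℂ)) ^ 2) Finset.univ.val :=
      heig ▸ Multiset.mem_map_of_mem _ (Finset.mem_univ i)
    obtain ⟨j, -, hj⟩ := Multiset.mem_map.1 hmem
    simp [h, (hσ0 j).ne'] at hj
  have hdet : IsUnit (A * A.conjTranspose).det := by
    rw [hG.det_eq_prod_eigenvalues, isUnit_iff_ne_zero, Finset.prod_ne_zero_iff]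
    exact fun i _ => Complex.ofReal_ne_zero.2 (hne i)
  have htrace : (A * A.conjTranspose)⁻¹.trace = ((∑ j, (σ j ^ 2)⁻¹ : ℝ) : ℂ) := by
    have h := congrArg (fun s => (Multiset.map (fun z : ℂ => z⁻¹) s).sum) heig
    simp only [Multiset.map_map, Function.comp_def] at h
    rw [hG.trace_inv_eq_sum_inv_eigenvalues hne]
    push_cast
    exact h
  have hupper : ∑ j, (σ j ^ 2)⁻¹ ≤ (n' : ℝ) / D ^ 2 := by
    have h : ∑ j, (σ j ^ 2)⁻¹ = ∑ j, RCLike.re ((A * A.conjTranspose)⁻¹ j j) := by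
      rw [← map_sum]
      exact (congrArg Complex.re htrace).symm
    calc ∑ j, (σ j ^ 2)⁻¹ ≤ ∑ _j : Fin n', 1 / D ^ 2 := h ▸ Finset.sum_le_sum fun j _ =>
          Matrix.re_inv_mul_conjTranspose_apply_self_le hdet hD j (hdist j)
      _ = (n' : ℝ) / D ^ 2 := by simp [div_eq_mul_inv]
  intro i
  have hlower := hσmono.sub_mul_inv_sq_le_sum_inv_sq hσ0 i
  refine ⟨hlower, hupper, ?_⟩
  have hi := hσ0 i
  have hn : (0 : ℝ) < n' := by exact_mod_cast hn'1
  have h := hlower.trans hupper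
  rw [← div_eq_mul_inv, div_le_div_iff₀ (by positivity) (by positivity)] at h
  refine le_of_sq_le_sq ?_ hi.le
  rw [mul_pow, Real.sq_sqrt (by positivity), mul_div_assoc', div_le_iff₀ hn]
  linarith
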